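/- arXiv:1002.2856 — 2 statements merged into one kernel-verified Lean document; each statement's English description precedes it below -/
import Mathlib

section
/- Under the relative isoperimetric hypothesis P_Ω{u > t} ≥ γ·μ(t)^(1−1/n) for a nonnegative Lipschitz function u with |Du| ≤ L, the decreasing rearrangement u* is locally absolutely continuous on (0, |Ω|) and satisfies 0 ≤ −du*/ds (s) ≤ (L/γ)·s^(−1+1/n) for almost every s. -/
open MeasureTheory Set Metric Filter

/-- The distribution function `μ(t) = |{x ∈ Ω : u(x) > t}|`. -/
noncomputable def distrib {n : ℕ} (Ω : Set (EuclideanSpace ℝ (Fin n)))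
    (u : EuclideanSpace ℝ (Fin n) → ℝ) (t : ℝ) : ℝ :=
  (volume {x ∈ Ω | t < u x}).toReal

/-- The decreasing rearrangement `u*(s) = inf {t : μ(t) ≤ s}`. -/
noncomputable def rearr {n : ℕ} (Ω : Set (EuclideanSpace ℝ (Fin n)))
    (u : EuclideanSpace ℝ (Fin n) → ℝ) (s : ℝ) : ℝ :=
  sInf {t : ℝ | distrib Ω u t ≤ s}


/-- The De Giorgi perimeter of a set `E` relative to an open set `Ω`, defined by
duality with compactly supported `C¹` vector fields of norm at most one. -/
noncomputable def relPerimeter {n : ℕ} (Ω E : Set (EuclideanSpace ℝ (Fin n))) : ℝ :=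
  sSup { r : ℝ | ∃ φ : EuclideanSpace ℝ (Fin n) → EuclideanSpace ℝ (Fin n),
    ContDiff ℝ 1 φ ∧ HasCompactSupport φ ∧ tsupport φ ⊆ Ω ∧ (∀ x, ‖φ x‖ ≤ 1) ∧
    r = ∫ x in E, ∑ i, fderiv ℝ φ x (EuclideanSpace.single i 1) i }


open scoped Topology

/-- A Lipschitz function whose differential vanishes outside `A` (wherever `φ ≠ 0`) pairs with the
divergence of a unit field `φ` to at most its Lipschitz constant times the volume of `A`. -/
lemma integral_lipschitz_mul_div_le {n : ℕ} {K : NNReal} {V : EuclideanSpace ℝ (Fin n) → ℝ}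
    (hV : LipschitzWith K V) {φ : EuclideanSpace ℝ (Fin n) → EuclideanSpace ℝ (Fin n)}
    (hφ : ContDiff ℝ 1 φ) (hc : HasCompactSupport φ) (h1 : ∀ x, ‖φ x‖ ≤ 1)
    {A : Set (EuclideanSpace ℝ (Fin n))} (hA : MeasurableSet A) (hAf : volume A ≠ ⊤)
    (h0 : ∀ x ∉ A, φ x = 0 ∨ fderiv ℝ V x = 0) :
    ∫ x, V x * ∑ i, fderiv ℝ φ x (EuclideanSpace.single i 1) i ≤ K * (volume A).toReal := by
  have hφi (i : Fin n) : ContDiff ℝ 1 fun x ↦ φ x i := by fun_prop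
  have hci (i : Fin n) : HasCompactSupport fun x ↦ φ x i :=
    hc.comp_left (g := fun y : EuclideanSpace ℝ (Fin n) ↦ y i) rfl
  have hdi (i : Fin n) (x v) : fderiv ℝ (fun x ↦ φ x i) x v = fderiv ℝ φ x v i := by
    have h := ((EuclideanSpace.proj (𝕜 := ℝ) i).hasFDerivAt.comp x
      (hφ.differentiable one_ne_zero x).hasFDerivAt)
    have h' : fderiv ℝ (fun x ↦ φ x i) x = _ := h.fderiv
    rw [h']
    rfl
  have hparts (i : Fin n) : ∫ x, V x * fderiv ℝ φ x (EuclideanSpace.single i 1) i =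
      - ∫ x, lineDeriv ℝ V x (EuclideanSpace.single i 1) * φ x i := by
    obtain ⟨D, hD⟩ := ContDiff.lipschitzWith_of_hasCompactSupport (hci i) (hφi i) one_ne_zero
    rw [hV.integral_lineDeriv_mul_eq hD (hci i), ← integral_neg]
    congr 1 with x
    rw [((hφi i).differentiable one_ne_zero x).lineDeriv_eq_fderiv, map_neg, hdi]
    ring
  have hint (i : Fin n) :
      Integrable fun x ↦ V x * fderiv ℝ φ x (EuclideanSpace.single i 1) i := by
    refine Continuous.integrable_of_hasCompactSupport ?_ ?_
    · have h2 : Continuous fun x ↦ fderiv ℝ (fun x ↦ φ x i) x (EuclideanSpace.single i 1) :=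
        ((hφi i).continuous_fderiv one_ne_zero).clm_apply continuous_const
      simp only [hdi] at h2
      exact hV.continuous.mul h2
    · refine HasCompactSupport.mul_left ?_
      exact (hc.fderiv ℝ).comp_left
        (g := fun T : EuclideanSpace ℝ (Fin n) →L[ℝ] EuclideanSpace ℝ (Fin n) ↦
          T (EuclideanSpace.single i 1) i) (by simp)
  have hint' (i : Fin n) :
      Integrable fun x ↦ lineDeriv ℝ V x (EuclideanSpace.single i 1) * φ x i := by
    refine Integrable.bdd_mul (c := K * ‖EuclideanSpace.single i (1 : ℝ)‖)
      ((hφi i).continuous.integrable_of_hasCompactSupport (hci i)) ?_ ?_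
    · exact aestronglyMeasurable_lineDeriv hV.continuous _
    · exact Eventually.of_forall fun x ↦ norm_lineDeriv_le_of_lipschitz ℝ hV
  simp_rw [Finset.mul_sum]
  rw [integral_finsetSum _ fun i _ ↦ hint i]
  simp_rw [hparts]
  rw [Finset.sum_neg_distrib, ← integral_finsetSum _ fun i _ ↦ hint' i, ← integral_neg]
  have hind : ∫ x, A.indicator (fun _ ↦ (K : ℝ)) x = K * (volume A).toReal := by
    rw [integral_indicator hA, setIntegral_const, smul_eq_mul, mul_comm]
    rfl
  rw [← hind]
  refine integral_mono_ae (integrable_finsetSum _ fun i _ ↦ hint' i).neg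
    ((integrable_indicator_iff hA).2 (integrableOn_const hAf)) ?_
  filter_upwards [hV.ae_differentiableAt (μ := volume)] with x hx
  have hsum : ∑ i, lineDeriv ℝ V x (EuclideanSpace.single i 1) * φ x i = fderiv ℝ V x (φ x) := by
    have hb := (EuclideanSpace.basisFun (Fin n) ℝ).sum_repr (φ x)
    conv_rhs => rw [← hb, map_sum]
    refine Finset.sum_congr rfl fun i _ ↦ ?_
    rw [hx.lineDeriv_eq_fderiv, map_smul, smul_eq_mul, mul_comm]
    simp
  simp only [hsum]
  by_cases hxA : x ∈ A
  · rw [indicator_of_mem hxA]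
    calc -(fderiv ℝ V x (φ x)) ≤ ‖fderiv ℝ V x (φ x)‖ := neg_le_abs _
      _ ≤ ‖fderiv ℝ V x‖ * ‖φ x‖ := ContinuousLinearMap.le_opNorm _ _
      _ ≤ K * 1 := by
        gcongr
        · exact norm_fderiv_le_of_lipschitz ℝ hV
        · exact h1 x
      _ = K := mul_one _
  · rw [indicator_of_notMem hxA]
    rcases h0 x hxA with h | h <;> simp [h]

lemma antitone_distrib {n : ℕ} {Ω : Set (EuclideanSpace ℝ (Fin n))} (hΩ : volume Ω ≠ ⊤)
    (u : EuclideanSpace ℝ (Fin n) → ℝ) : Antitone (distrib Ω u) := fun _ _ hst ↦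
  ENNReal.toReal_mono (measure_ne_top_of_subset (fun _ hx ↦ hx.1) hΩ)
    (measure_mono fun _ hx ↦ ⟨hx.1, hst.trans_lt hx.2⟩)

/-- The local form of the coarea inequality: the perimeter of a superlevel set is controlled by the
lower right Dini derivative of minus the distribution function. -/
lemma eventually_mul_le_distrib_sub {n : ℕ} {Ω : Set (EuclideanSpace ℝ (Fin n))}
    {u : EuclideanSpace ℝ (Fin n) → ℝ} (hΩo : IsOpen Ω) (hΩ : volume Ω ≠ ⊤) {L : NNReal}
    (hu : LipschitzWith L u) {t c : ℝ} (hc : c < relPerimeter Ω {x ∈ Ω | t < u x}) :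
    ∀ᶠ h in 𝓝[>] (0 : ℝ), c * h ≤ L * (distrib Ω u t - distrib Ω u (t + h)) := by
  have hm (s : ℝ) : MeasurableSet {x ∈ Ω | s < u x} :=
    (hΩo.inter (isOpen_lt continuous_const hu.continuous)).measurableSet
  have hfin (s : ℝ) : volume {x ∈ Ω | s < u x} ≠ ⊤ :=
    measure_ne_top_of_subset (fun _ hx ↦ hx.1) hΩ
  rw [relPerimeter] at hc
  obtain ⟨_, ⟨φ, hφ, hφc, hφΩ, hφ1, rfl⟩, hcr⟩ := exists_lt_of_lt_csSup (by
    exact ⟨_, 0, contDiff_const, HasCompactSupport.zero, by simp [tsupport], by simp, rfl⟩) hc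
  set E := {x ∈ Ω | t < u x}
  set d := fun x ↦ ∑ i, fderiv ℝ φ x (EuclideanSpace.single i 1) i
  have hdc : Continuous d := by
    have := hφ.continuous_fderiv one_ne_zero
    fun_prop
  have hds : HasCompactSupport d :=
    (hφc.fderiv ℝ).comp_left
      (g := fun T : EuclideanSpace ℝ (Fin n) →L[ℝ] EuclideanSpace ℝ (Fin n) ↦
        ∑ i, T (EuclideanSpace.single i 1) i) (by simp)
  have hd0 : ∀ x ∉ Ω, d x = 0 := fun x hx ↦ by
    have : fderiv ℝ φ x = 0 := by
      by_contra hne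
      exact hx (hφΩ (support_fderiv_subset ℝ hne))
    simp [d, this]
  set w : ℝ → EuclideanSpace ℝ (Fin n) → ℝ := fun h x ↦ min (max (u x - t) 0) h
  have hw (h : ℝ) : LipschitzWith L (w h) := by
    have : LipschitzWith L fun x ↦ u x - t :=
      LipschitzWith.of_dist_le_mul fun x y ↦ by simpa using hu.dist_le_mul x y
    exact (this.max_const 0).min_const h
  have hlim : Tendsto (fun h ↦ ∫ x, h⁻¹ * (w h x * d x)) (𝓝[>] 0) (𝓝 (∫ x in E, d x)) := by
    rw [← integral_indicator (hm t)]
    refine tendsto_integral_filter_of_dominated_convergence (fun x ↦ ‖d x‖) ?_ ?_ ?_ ?_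
    · exact Eventually.of_forall fun h ↦
        (continuous_const.mul ((hw h).continuous.mul hdc)).aestronglyMeasurable
    · filter_upwards [self_mem_nhdsWithin] with h (hh : 0 < h)
      refine Eventually.of_forall fun x ↦ ?_
      have h1 : 0 ≤ w h x := le_min (le_max_right _ _) hh.le
      have h2 : h⁻¹ * w h x ≤ 1 := by
        rw [inv_mul_le_iff₀ hh, mul_one]; exact min_le_right _ _
      rw [← mul_assoc, norm_mul, Real.norm_of_nonneg (by positivity)]
      exact mul_le_of_le_one_left (norm_nonneg _) h2
    · exact (hdc.integrable_of_hasCompactSupport hds).norm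
    · refine Eventually.of_forall fun x ↦ tendsto_const_nhds.congr' ?_
      by_cases hx : x ∈ Ω
      · by_cases hxt : t < u x
        · have : Iio (u x - t) ∈ 𝓝[>] (0 : ℝ) :=
            mem_nhdsWithin_of_mem_nhds (Iio_mem_nhds (by linarith))
          filter_upwards [self_mem_nhdsWithin, this] with h (hh : 0 < h) (hh' : h < u x - t)
          have : w h x = h := min_eq_right (hh'.le.trans (le_max_left _ _))
          rw [indicator_of_mem (show x ∈ E from ⟨hx, hxt⟩), this]
          field_simp
        · filter_upwards [self_mem_nhdsWithin] with h (hh : 0 < h)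
          have : w h x = 0 := by
            simp only [w]
            rw [max_eq_right (by linarith), min_eq_left hh.le]
          rw [indicator_of_notMem (fun hE : x ∈ E ↦ hxt hE.2), this]
          simp
      · refine Eventually.of_forall fun h ↦ ?_
        rw [indicator_of_notMem (fun hE : x ∈ E ↦ hx hE.1), hd0 x hx]
        simp
  filter_upwards [hlim.eventually_const_lt hcr, self_mem_nhdsWithin] with h hch (hh : 0 < h)
  rw [integral_const_mul, lt_inv_mul_iff₀ hh, mul_comm] at hch
  refine hch.le.trans ?_
  have hsub : {x ∈ Ω | t + h < u x} ⊆ E := fun x hx ↦ ⟨hx.1, by linarith [hx.2]⟩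
  have key := integral_lipschitz_mul_div_le (hw h) hφ hφc hφ1 ((hm t).diff (hm (t + h)))
    (measure_ne_top_of_subset sdiff_subset (hfin t)) ?_
  · refine key.trans_eq ?_
    rw [measure_sdiff hsub (hm _).nullMeasurableSet (hfin _),
      ENNReal.toReal_sub_of_le (measure_mono hsub) (hfin t)]
    rfl
  · intro x hx
    by_cases hxΩ : x ∈ Ω
    · right
      by_cases hxt : t < u x
      · have hxh : t + h < u x := by
          by_contra hcon
          exact hx ⟨⟨hxΩ, hxt⟩, fun h' ↦ hcon h'.2⟩
        refine IsLocalMax.fderiv_eq_zero (Eventually.of_forall fun y ↦ ?_)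
        have : w h x = h := min_eq_right (le_max_of_le_left (by linarith))
        rw [this]
        exact min_le_right _ _
      · refine IsLocalMin.fderiv_eq_zero (Eventually.of_forall fun y ↦ ?_)
        have : w h x = 0 := by
          simp only [w]
          rw [max_eq_right (by linarith), min_eq_left hh.le]
        rw [this]
        exact le_min (le_max_right _ _) hh.le
    · left
      exact image_eq_zero_of_notMem_tsupport fun h' ↦ hxΩ (hφΩ h')

/-- An antitone function with right Dini derivative at most `-c` decreases at rate at least `c`. -/
lemma Antitone.mul_sub_le_of_eventually {f : ℝ → ℝ} (hf : Antitone f) {c a b : ℝ} (hab : a ≤ b)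
    (h : ∀ x ∈ Ico a b, ∀ᶠ r in 𝓝[>] (0 : ℝ), c * r ≤ f x - f (x + r)) :
    c * (b - a) ≤ f a - f b := by
  set S := {x ∈ Icc a b | c * (x - a) ≤ f a - f x}
  have haS : a ∈ S := ⟨left_mem_Icc.2 hab, by simp⟩
  have hbdd : BddAbove S := ⟨b, fun x hx ↦ hx.1.2⟩
  set σ := sSup S
  have hσS : σ ∈ S := by
    refine ⟨⟨le_csSup hbdd haS, csSup_le ⟨a, haS⟩ fun x hx ↦ hx.1.2⟩, ?_⟩
    have hcl : IsClosed {x | c * (x - a) ≤ f a - f σ} :=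
      isClosed_le (by fun_prop) continuous_const
    have hsub : S ⊆ {x | c * (x - a) ≤ f a - f σ} := fun x hx ↦
      hx.2.trans (sub_le_sub_left (hf (le_csSup hbdd hx)) _)
    exact closure_minimal hsub hcl (csSup_mem_closure ⟨a, haS⟩ hbdd)
  rcases hσS.1.2.eq_or_lt with he | hlt
  · simpa [he] using hσS.2
  · have hev : Iio (b - σ) ∈ 𝓝[>] (0 : ℝ) :=
      mem_nhdsWithin_of_mem_nhds (Iio_mem_nhds (by linarith))
    obtain ⟨r, ⟨hr, hrb : r < b - σ⟩, hr0 : 0 < r⟩ :=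
      (((h σ ⟨hσS.1.1, hlt⟩).and hev).and self_mem_nhdsWithin).exists
    have hmem : σ + r ∈ S :=
      ⟨⟨by linarith [hσS.1.1], by linarith⟩, by linarith [hσS.2]⟩
    linarith [le_csSup hbdd hmem]

lemma mul_sub_mul_distrib_rpow_le {n : ℕ} {Ω : Set (EuclideanSpace ℝ (Fin n))}
    {u : EuclideanSpace ℝ (Fin n) → ℝ} (hΩo : IsOpen Ω) (hΩ : volume Ω ≠ ⊤) {L : NNReal}
    (hu : LipschitzWith L u) {γ p : ℝ} (hγ : 0 ≤ γ) (hp : 0 ≤ p)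
    (hiso : ∀ t : ℝ, 0 ≤ t → γ * distrib Ω u t ^ p ≤ relPerimeter Ω {x ∈ Ω | t < u x})
    {a b : ℝ} (ha : 0 ≤ a) (hab : a < b) :
    γ * distrib Ω u b ^ p * (b - a) ≤ L * (distrib Ω u a - distrib Ω u b) := by
  have hanti := antitone_distrib hΩ u
  have hab' : 0 < b - a := sub_pos.2 hab
  rw [← le_div_iff₀ hab']
  refine le_of_forall_lt_imp_le_of_dense fun c hc ↦ ?_
  rw [le_div_iff₀ hab', mul_sub (L : ℝ)]
  refine Antitone.mul_sub_le_of_eventually (f := fun t ↦ L * distrib Ω u t)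
    (fun s t hst ↦ mul_le_mul_of_nonneg_left (hanti hst) L.2) hab.le fun x hx ↦ ?_
  simp only [← mul_sub]
  refine eventually_mul_le_distrib_sub hΩo hΩ hu (hc.trans_le (le_trans ?_
    (hiso x (ha.trans hx.1))))
  gcongr
  · exact ENNReal.toReal_nonneg
  · exact hanti hx.2.le

/-- On an interval where an antitone function has difference quotients bounded by `C`,
minus its derivative obeys the same bound. -/
lemma neg_deriv_mem_Icc_of_sub_le {f C : ℝ → ℝ} {a b s : ℝ} (hs : s ∈ Ioo a b)
    (hf : AntitoneOn f (Ioo a b))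
    (h : ∀ x ∈ Ioo a b, ∀ y ∈ Ioo a b, x ≤ y → f x - f y ≤ C x * (y - x)) (hC0 : 0 ≤ C s) :
    -deriv f s ∈ Icc 0 (C s) := by
  by_cases hd : DifferentiableAt ℝ f s
  · have hslope := hd.hasDerivAt.tendsto_slope.mono_left
      (nhdsWithin_mono s (fun x (hx : s < x) ↦ hx.ne') : 𝓝[>] s ≤ 𝓝[≠] s)
    have hev : Ioo s b ∈ 𝓝[>] s := Ioo_mem_nhdsGT hs.2
    have hb : ∀ᶠ y in 𝓝[>] s, slope f s y ∈ Icc (-C s) 0 := by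
      filter_upwards [hev] with y hy
      have hy' : y ∈ Ioo a b := ⟨hs.1.trans hy.1, hy.2⟩
      have hpos : 0 < y - s := sub_pos.2 hy.1
      rw [slope_def_field]
      refine ⟨?_, div_nonpos_of_nonpos_of_nonneg
        (sub_nonpos.2 (hf hs hy' hy.1.le)) hpos.le⟩
      rw [le_div_iff₀ hpos]
      linarith [h s hs y hy' hy.1.le]
    have := isClosed_Icc.mem_of_tendsto hslope hb
    exact ⟨by linarith [this.2], by linarith [this.1]⟩
  · simp [deriv_zero_of_not_differentiableAt hd, hC0]

theorem rearr_locally_ac_of_isoperimetric {n : ℕ} (hn : 2 ≤ n)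
    (Ω : Set (EuclideanSpace ℝ (Fin n))) (u : EuclideanSpace ℝ (Fin n) → ℝ)
    (hΩo : IsOpen Ω) (hΩbd : Bornology.IsBounded Ω)
    (L : NNReal) (hL : 0 < (L : ℝ)) (hu : LipschitzOnWith L u Ω)
    (hu0 : ∀ x ∈ Ω, 0 ≤ u x)
    (γ : ℝ) (hγ : 0 < γ)
    (hiso : ∀ t : ℝ, 0 ≤ t →
      γ * (distrib Ω u t) ^ ((1 : ℝ) - 1 / n) ≤ relPerimeter Ω {x ∈ Ω | t < u x}) :
    ∃ g : ℝ → ℝ,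
      (∀ a b : ℝ, 0 < a → b < (volume Ω).toReal →
        MeasureTheory.IntegrableOn g (Set.Icc a b)) ∧
      (∀ s ∈ Set.Ioo (0 : ℝ) (volume Ω).toReal,
        ∀ s' ∈ Set.Ioo (0 : ℝ) (volume Ω).toReal, s ≤ s' →
          rearr Ω u s' = rearr Ω u s - ∫ σ in s..s', g σ) ∧
      (∀ᵐ s ∂(volume.restrict (Set.Ioo (0 : ℝ) (volume Ω).toReal)),
        0 ≤ g s ∧ g s ≤ (L / γ) * s ^ (-1 + 1 / (n : ℝ))) := by
  have hΩ : volume Ω ≠ ⊤ := hΩbd.measure_lt_top.ne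
  obtain ⟨U, hU, hUu⟩ := hu.extend_real
  have hset (t : ℝ) : {x ∈ Ω | t < u x} = {x ∈ Ω | t < U x} := by
    ext x
    exact and_congr_right fun hx ↦ by rw [hUu hx]
  have hdist (t : ℝ) : distrib Ω U t = distrib Ω u t := by simp only [distrib, hset]
  set M := (volume Ω).toReal
  set p : ℝ := 1 - 1 / n
  have hp : 0 ≤ p := by
    have : (1 : ℝ) / n ≤ 1 := by
      rw [div_le_one (by positivity)]
      exact_mod_cast (by lia : 1 ≤ n)
    exact sub_nonneg.2 this
  have hanti := antitone_distrib hΩ u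
  have hgrowth {a b : ℝ} (ha : 0 ≤ a) (hab : a < b) :
      γ * distrib Ω u b ^ p * (b - a) ≤ L * (distrib Ω u a - distrib Ω u b) := by
    have := mul_sub_mul_distrib_rpow_le (p := p) hΩo hΩ hU hγ.le hp
      (fun t ht ↦ by rw [hdist, ← hset]; exact hiso t ht) ha hab
    simpa only [hdist] using this
  have hneg (s t : ℝ) (hs : s < M) (ht : distrib Ω u t ≤ s) : 0 ≤ t := by
    by_contra! hcon
    have : {x ∈ Ω | t < u x} = Ω := by
      ext x
      exact ⟨fun hx ↦ hx.1, fun hx ↦ ⟨hx, hcon.trans_le (hu0 x hx)⟩⟩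
    rw [distrib, this] at ht
    exact absurd hs ht.not_gt
  obtain ⟨T, hT⟩ : ∃ T, distrib Ω u T = 0 := by
    obtain ⟨T, hT⟩ := (hU.isBounded_image hΩbd).bddAbove
    refine ⟨T, ?_⟩
    have : {x ∈ Ω | T < u x} = ∅ := by
      rw [hset]
      exact eq_empty_of_forall_notMem fun x hx ↦ (hT ⟨x, hx.1, rfl⟩).not_gt hx.2
    simp [distrib, this]
  have hbdd (s : ℝ) (hs : s < M) : BddBelow {t | distrib Ω u t ≤ s} := ⟨0, fun t ↦ hneg s t hs⟩
  have hne (s : ℝ) (hs : 0 < s) : {t | distrib Ω u t ≤ s}.Nonempty := ⟨T, by simp [hT, hs.le]⟩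
  have hr_anti : AntitoneOn (rearr Ω u) (Ioo 0 M) := fun s hs s' hs' hss ↦
    csInf_le_csInf (hbdd s' hs'.2) (hne s hs.1) fun t ht ↦ le_trans ht hss
  have hpow (s : ℝ) (hs : 0 < s) : s ^ (-1 + 1 / (n : ℝ)) = (s ^ p)⁻¹ := by
    rw [← Real.rpow_neg hs.le]
    congr 1
    ring
  set C : ℝ → ℝ := fun s ↦ (L / γ) * s ^ (-1 + 1 / (n : ℝ))
  have hC0 (s : ℝ) (hs : 0 < s) : 0 ≤ C s := by positivity
  have hr_sub : ∀ s ∈ Ioo 0 M, ∀ s' ∈ Ioo 0 M, s ≤ s' →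
      rearr Ω u s - rearr Ω u s' ≤ C s * (s' - s) := by
    intro s hs s' hs' hss
    by_contra! hcon
    have hd0 : 0 ≤ C s * (s' - s) := mul_nonneg (hC0 s hs.1) (sub_nonneg.2 hss)
    set d := C s * (s' - s)
    set ε := (rearr Ω u s - rearr Ω u s' - d) / 4
    have hε : 0 < ε := div_pos (by linarith) (by norm_num)
    have hεd : rearr Ω u s - rearr Ω u s' = d + 4 * ε := by simp only [ε]; ring
    have h0 : 0 ≤ rearr Ω u s' := le_csInf (hne s' hs'.1) fun t ↦ hneg s' t hs'.2
    obtain ⟨t, ht, htlt⟩ := exists_lt_of_csInf_lt (hne s' hs'.1)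
      (show rearr Ω u s' < rearr Ω u s' + ε by linarith)
    have hlow : distrib Ω u (rearr Ω u s' + ε) ≤ s' := (hanti htlt.le).trans ht
    have hup : s < distrib Ω u (rearr Ω u s - ε) := by
      by_contra! hle
      have : rearr Ω u s ≤ rearr Ω u s - ε := csInf_le (hbdd s hs.2) hle
      linarith
    have hg := hgrowth (show 0 ≤ rearr Ω u s' + ε by linarith)
      (show rearr Ω u s' + ε < rearr Ω u s - ε by linarith)
    have hsp : 0 < s ^ p := Real.rpow_pos_of_pos hs.1 p
    have hmono : s ^ p ≤ distrib Ω u (rearr Ω u s - ε) ^ p :=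
      Real.rpow_le_rpow hs.1.le hup.le hp
    have h1 : γ * s ^ p * (d + 2 * ε) ≤ L * (s' - s) := by
      calc γ * s ^ p * (d + 2 * ε)
          ≤ γ * distrib Ω u (rearr Ω u s - ε) ^ p * (d + 2 * ε) := by gcongr
        _ = γ * distrib Ω u (rearr Ω u s - ε) ^ p *
            (rearr Ω u s - ε - (rearr Ω u s' + ε)) := by congr 1; linarith
        _ ≤ _ := hg
        _ ≤ L * (s' - s) := by gcongr
    have h2 : γ * s ^ p * d = L * (s' - s) := by
      simp only [d, C, hpow s hs.1]
      field_simp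
    have h3 : 0 < γ * s ^ p * (2 * ε) := by positivity
    linarith [mul_add (γ * s ^ p) d (2 * ε)]
  have hderiv (s : ℝ) (hs : s ∈ Ioo 0 M) : -deriv (rearr Ω u) s ∈ Icc 0 (C s) :=
    neg_deriv_mem_Icc_of_sub_le hs hr_anti hr_sub (hC0 s hs.1)
  have hC_anti (a s : ℝ) (ha : 0 < a) (has : a ≤ s) : C s ≤ C a := by
    simp only [C, hpow a ha, hpow s (ha.trans_le has)]
    gcongr
  refine ⟨fun s ↦ -deriv (rearr Ω u) s, fun a b ha hb ↦ ?_, fun s hs s' hs' hss ↦ ?_, ?_⟩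
  · refine Measure.integrableOn_of_bounded (M := C a) measure_Icc_lt_top.ne
      (measurable_deriv _).neg.aestronglyMeasurable ?_
    filter_upwards [ae_restrict_mem measurableSet_Icc] with s hs
    have := hderiv s ⟨ha.trans_le hs.1, hs.2.trans_lt hb⟩
    rw [Real.norm_of_nonneg this.1]
    exact this.2.trans (hC_anti a s ha hs.1)
  · have hlip : LipschitzOnWith (C s).toNNReal (rearr Ω u) (uIcc s s') := by
      rw [uIcc_of_le hss]
      have hsub : Icc s s' ⊆ Ioo 0 M := Icc_subset_Ioo hs.1 hs'.2
      refine LipschitzOnWith.of_le_add_mul _ fun x hx y hy ↦ ?_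
      rw [Real.coe_toNNReal _ (hC0 s hs.1), Real.dist_eq]
      rcases le_total x y with hxy | hxy
      · have h1 := hr_sub x (hsub hx) y (hsub hy) hxy
        have h2 := mul_le_mul_of_nonneg_right (hC_anti s x hs.1 hx.1) (sub_nonneg.2 hxy)
        rw [abs_sub_comm, abs_of_nonneg (sub_nonneg.2 hxy)]
        linarith
      · have := hr_anti (hsub hy) (hsub hx) hxy
        have := mul_nonneg (hC0 s hs.1) (abs_nonneg (x - y))
        linarith
    rw [intervalIntegral.integral_neg,
      hlip.absolutelyContinuousOnInterval.integral_deriv_eq_sub]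
    ring
  · filter_upwards [ae_restrict_mem measurableSet_Ioo] with s hs
    exact hderiv s hs
end

section
/- If u is nonnegative Lipschitz on a bounded Lipschitz domain Ω ⊆ ℝⁿ (n ≥ 2) and P_Ω{u > t} ≥ γ·μ(t)^(1−1/n) for all t ≥ 0 and some γ > 0, then ∫_{Ω̃} |Dũ|² dx ≤ (n·cₙ^(1/n)/γ)² · ∫_Ω |Du|² dx. -/
open MeasureTheory Set Metric Filter

/-- `cₙ`: the volume of the unit ball in `ℝⁿ`. -/
noncomputable def unitBallVol (n : ℕ) : ℝ :=
  (volume (Metric.ball (0 : EuclideanSpace ℝ (Fin n)) 1)).toReal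

/-- `Ω̃`: the open ball centred at the origin with the same measure as `Ω`. -/
noncomputable def ballSameVol {n : ℕ} (Ω : Set (EuclideanSpace ℝ (Fin n))) :
    Set (EuclideanSpace ℝ (Fin n)) :=
  Metric.ball 0 (((volume Ω).toReal / unitBallVol n) ^ ((1 : ℝ) / n))

/-- The Schwarz symmetrization `ũ(x) = u*(cₙ |x|ⁿ)`. -/
noncomputable def schwarz {n : ℕ} (Ω : Set (EuclideanSpace ℝ (Fin n)))
    (u : EuclideanSpace ℝ (Fin n) → ℝ) (x : EuclideanSpace ℝ (Fin n)) : ℝ :=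
  rearr Ω u (unitBallVol n * ‖x‖ ^ n)

/-- Integration by parts of a Lipschitz function against a compactly supported `C¹` vector field. -/
theorem integral_mul_div_eq_neg_integral_fderiv_apply {n : ℕ} {K : NNReal}
    {g : EuclideanSpace ℝ (Fin n) → ℝ} (hg : LipschitzWith K g)
    {φ : EuclideanSpace ℝ (Fin n) → EuclideanSpace ℝ (Fin n)} (hφ : ContDiff ℝ 1 φ)
    (hφc : HasCompactSupport φ) :
    ∫ x, g x * ∑ i, fderiv ℝ φ x (EuclideanSpace.single i 1) i = -∫ x, fderiv ℝ g x (φ x) := by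
  have hcomp : ∀ i, ContDiff ℝ 1 fun x => φ x i := fun i =>
    (EuclideanSpace.proj (𝕜 := ℝ) i).contDiff.comp hφ
  have hcompc : ∀ i, HasCompactSupport fun x => φ x i := fun i =>
    hφc.comp_left (g := fun y : EuclideanSpace ℝ (Fin n) => y i) rfl
  have hd : ∀ x i v, fderiv ℝ φ x v i = fderiv ℝ (fun y => φ y i) x v := by
    intro x i v
    have h := (EuclideanSpace.proj (𝕜 := ℝ) i).hasFDerivAt.comp x
      (hφ.differentiable one_ne_zero x).hasFDerivAt
    have h' := h.fderiv
    change fderiv ℝ (fun y => φ y i) x = _ at h'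
    rw [h']
    rfl
  have hint : ∀ i, Integrable fun x => g x * fderiv ℝ φ x (EuclideanSpace.single i 1) i := by
    intro i
    simp only [hd]
    refine Continuous.integrable_of_hasCompactSupport ?_ ?_
    · exact hg.continuous.mul
        (((hcomp i).continuous_fderiv one_ne_zero).clm_apply continuous_const)
    · exact ((hcompc i).fderiv_apply (𝕜 := ℝ) _).mul_left
  have hint' : ∀ i, Integrable fun x =>
      lineDeriv ℝ g x (EuclideanSpace.single i 1) * φ x i := by
    intro i
    refine Integrable.bdd_mul
      ((hcomp i).continuous.integrable_of_hasCompactSupport (hcompc i))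
      (measurable_lineDeriv hg.continuous).aestronglyMeasurable
      (Eventually.of_forall fun x => norm_lineDeriv_le_of_lipschitz ℝ hg)
  have key : ∀ i, ∫ x, g x * fderiv ℝ φ x (EuclideanSpace.single i 1) i
      = -∫ x, lineDeriv ℝ g x (EuclideanSpace.single i 1) * φ x i := by
    intro i
    obtain ⟨D, hD⟩ := ContDiff.lipschitzWith_of_hasCompactSupport (hcompc i) (hcomp i) one_ne_zero
    rw [hg.integral_lineDeriv_mul_eq hD (hcompc i), ← integral_neg]
    refine integral_congr_ae (Eventually.of_forall fun x => ?_)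
    simp only [((hcomp i).differentiable one_ne_zero x).lineDeriv_eq_fderiv, hd, map_neg]
    ring
  simp only [Finset.mul_sum]
  rw [integral_finsetSum _ fun i _ => hint i, Finset.sum_congr rfl fun i _ => key i,
    Finset.sum_neg_distrib, ← integral_finsetSum _ fun i _ => hint' i]
  congr 1
  refine integral_congr_ae ?_
  filter_upwards [hg.ae_differentiableAt (μ := volume)] with x hx
  have hb := (EuclideanSpace.basisFun (Fin n) ℝ).sum_repr (φ x)
  conv_rhs => rw [← hb]
  simp [map_sum, hx.lineDeriv_eq_fderiv, mul_comm]

/-- The truncation of `u` between the levels `t` and `t + h`, rescaled to take values in `[0, 1]`,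
has derivative supported in the strip `{t < u ≤ t + h}`. -/
theorem norm_fderiv_truncation_le {n : ℕ} (u : EuclideanSpace ℝ (Fin n) → ℝ)
    (hu : Continuous u) {t h : ℝ} (hh : 0 < h) (x : EuclideanSpace ℝ (Fin n)) :
    ‖fderiv ℝ (fun y => max 0 (min 1 (h⁻¹ * (u y - t)))) x‖
      ≤ {y | t < u y ∧ u y ≤ t + h}.indicator (fun y => h⁻¹ * ‖fderiv ℝ u y‖) x := by
  have hind : 0 ≤ {y | t < u y ∧ u y ≤ t + h}.indicator (fun y => h⁻¹ * ‖fderiv ℝ u y‖) x :=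
    indicator_nonneg (fun y _ => by positivity) x
  by_cases h1 : u x ≤ t
  · have : IsLocalMin (fun y => max 0 (min 1 (h⁻¹ * (u y - t)))) x := by
      refine Eventually.of_forall fun y => ?_
      have : h⁻¹ * (u x - t) ≤ 0 := mul_nonpos_of_nonneg_of_nonpos (by positivity) (by linarith)
      simp only
      rw [max_eq_left (le_trans (min_le_right _ _) this)]
      exact le_max_left _ _
    rw [this.fderiv_eq_zero]
    simpa using hind
  by_cases h2 : t + h ≤ u x
  · have : IsLocalMax (fun y => max 0 (min 1 (h⁻¹ * (u y - t)))) x := by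
      refine Eventually.of_forall fun y => ?_
      have : 1 ≤ h⁻¹ * (u x - t) := by
        rw [inv_mul_eq_div, le_div_iff₀ hh]
        linarith
      simp only
      rw [min_eq_left this]
      exact max_le (le_max_left _ _) ((min_le_left _ _).trans (le_max_right _ _))
    rw [this.fderiv_eq_zero]
    simpa using hind
  push Not at h1 h2
  have hev : (fun y => max 0 (min 1 (h⁻¹ * (u y - t)))) =ᶠ[nhds x] fun y => h⁻¹ * (u y - t) := by
    filter_upwards [hu.continuousAt.eventually (lt_mem_nhds h1),
      hu.continuousAt.eventually (gt_mem_nhds h2)] with y hy1 hy2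
    rw [min_eq_right, max_eq_right]
    · exact mul_nonneg (by positivity) (by linarith)
    · rw [inv_mul_eq_div, div_le_iff₀ hh]
      linarith
  rw [hev.fderiv_eq, indicator_of_mem (show x ∈ {y | t < u y ∧ u y ≤ t + h} from ⟨h1, h2.le⟩)]
  have : (fun y => h⁻¹ * (u y - t)) = h⁻¹ • fun y => u y - t := rfl
  rw [this, fderiv_const_smul_field, Pi.smul_apply, fderiv_sub_const]
  simp only [norm_smul, norm_inv, Real.norm_eq_abs, abs_of_pos hh, le_refl]

theorem lipschitzWith_truncation {n : ℕ} {K : NNReal} {u : EuclideanSpace ℝ (Fin n) → ℝ}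
    (hu : LipschitzWith K u) (t h : ℝ) :
    ∃ C, LipschitzWith C fun y => max 0 (min 1 (h⁻¹ * (u y - t))) := by
  have h1 : LipschitzWith (‖h⁻¹‖₊ * (K + 0)) fun y => h⁻¹ * (u y - t) :=
    (lipschitzWith_smul h⁻¹).comp (hu.sub (LipschitzWith.const t))
  exact ⟨_, ((h1.const_min 1).const_max 0)⟩

theorem integrableOn_norm_fderiv_pow {n : ℕ} {K : NNReal} {u : EuclideanSpace ℝ (Fin n) → ℝ}
    (hu : LipschitzWith K u) {S : Set (EuclideanSpace ℝ (Fin n))} (hS : volume S ≠ ⊤) (k : ℕ) :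
    IntegrableOn (fun x => ‖fderiv ℝ u x‖ ^ k) S := by
  refine Measure.integrableOn_of_bounded hS
    ((measurable_fderiv ℝ u).norm.pow_const k).aestronglyMeasurable (M := (K : ℝ) ^ k)
    (Eventually.of_forall fun x => ?_)
  rw [norm_pow, norm_norm]
  gcongr
  exact norm_fderiv_le_of_lipschitz ℝ hu

theorem integral_truncation_mul_div_le {n : ℕ} {K : NNReal}
    {u : EuclideanSpace ℝ (Fin n) → ℝ} (hu : LipschitzWith K u)
    {Ω : Set (EuclideanSpace ℝ (Fin n))} (hΩ : MeasurableSet Ω) (hfin : volume Ω ≠ ⊤)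
    {φ : EuclideanSpace ℝ (Fin n) → EuclideanSpace ℝ (Fin n)} (hφ : ContDiff ℝ 1 φ)
    (hφc : HasCompactSupport φ) (hsupp : tsupport φ ⊆ Ω) (hφ1 : ∀ x, ‖φ x‖ ≤ 1)
    {t h : ℝ} (hh : 0 < h) :
    ∫ x, max 0 (min 1 (h⁻¹ * (u x - t))) * ∑ i, fderiv ℝ φ x (EuclideanSpace.single i 1) i
      ≤ h⁻¹ * ∫ x in {x ∈ Ω | t < u x ∧ u x ≤ t + h}, ‖fderiv ℝ u x‖ := by
  obtain ⟨C, hC⟩ := lipschitzWith_truncation hu t h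
  have hm : MeasurableSet {x ∈ Ω | t < u x ∧ u x ≤ t + h} :=
    hΩ.inter ((measurableSet_lt measurable_const hu.continuous.measurable).inter
      (measurableSet_le hu.continuous.measurable measurable_const))
  rw [integral_mul_div_eq_neg_integral_fderiv_apply hC hφ hφc, ← integral_const_mul,
    ← integral_indicator hm]
  refine (neg_le_abs _).trans ?_
  rw [← Real.norm_eq_abs]
  refine norm_integral_le_of_norm_le ?_ (Eventually.of_forall fun x => ?_)
  · rw [integrable_indicator_iff hm]
    refine Integrable.const_mul ?_ _
    simpa only [pow_one, IntegrableOn] using integrableOn_norm_fderiv_pow hu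
      (ne_top_of_le_ne_top hfin (measure_mono (sep_subset Ω fun x => t < u x ∧ u x ≤ t + h))) 1
  · by_cases hx : x ∈ Ω
    · refine (ContinuousLinearMap.le_opNorm _ _).trans ?_
      refine (mul_le_of_le_one_right (norm_nonneg _) (hφ1 x)).trans ?_
      refine (norm_fderiv_truncation_le u hu.continuous hh x).trans (le_of_eq ?_)
      simp [indicator, hx]
    · have : φ x = 0 := image_eq_zero_of_notMem_tsupport fun hx' => hx (hsupp hx')
      rw [this, map_zero, norm_zero]
      exact indicator_nonneg (fun y _ => by positivity) x

theorem setIntegral_div_superlevel_le {n : ℕ} {K : NNReal}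
    {u : EuclideanSpace ℝ (Fin n) → ℝ} (hu : LipschitzWith K u)
    {Ω : Set (EuclideanSpace ℝ (Fin n))} (hΩ : MeasurableSet Ω) (hfin : volume Ω ≠ ⊤)
    {φ : EuclideanSpace ℝ (Fin n) → EuclideanSpace ℝ (Fin n)} (hφ : ContDiff ℝ 1 φ)
    (hφc : HasCompactSupport φ) (hsupp : tsupport φ ⊆ Ω) (hφ1 : ∀ x, ‖φ x‖ ≤ 1)
    {t c : ℝ} (hc : ∀ᶠ h in nhdsWithin 0 (Ioi 0),
      h⁻¹ * ∫ x in {x ∈ Ω | t < u x ∧ u x ≤ t + h}, ‖fderiv ℝ u x‖ ≤ c) :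
    ∫ x in {x ∈ Ω | t < u x}, ∑ i, fderiv ℝ φ x (EuclideanSpace.single i 1) i ≤ c := by
  have hm : MeasurableSet {x ∈ Ω | t < u x} :=
    hΩ.inter (measurableSet_lt measurable_const hu.continuous.measurable)
  have hdivc : Continuous fun x => ∑ i, fderiv ℝ φ x (EuclideanSpace.single i 1) i := by
    refine continuous_finsetSum _ fun i _ => ?_
    exact (EuclideanSpace.proj (𝕜 := ℝ) i).continuous.comp
      ((hφ.continuous_fderiv one_ne_zero).clm_apply continuous_const)
  have hdiv0 : ∀ x, x ∉ tsupport φ →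
      ∑ i, fderiv ℝ φ x (EuclideanSpace.single i 1) i = 0 := by
    intro x hx
    have : fderiv ℝ φ x = 0 := by
      by_contra hne
      exact hx (support_fderiv_subset ℝ hne)
    simp [this]
  have hdivi : Integrable fun x => ∑ i, fderiv ℝ φ x (EuclideanSpace.single i 1) i :=
    hdivc.integrable_of_hasCompactSupport (HasCompactSupport.intro hφc hdiv0)
  refine le_of_tendsto (x := nhdsWithin 0 (Ioi 0)) (f := fun h : ℝ => ∫ x, max 0 (min 1 (h⁻¹ * (u x - t))) *
      ∑ i, fderiv ℝ φ x (EuclideanSpace.single i 1) i) ?_ ?_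
  · rw [← integral_indicator hm]
    refine tendsto_integral_filter_of_dominated_convergence
      (fun x => ‖∑ i, fderiv ℝ φ x (EuclideanSpace.single i 1) i‖) ?_ ?_ hdivi.norm ?_
    · refine Eventually.of_forall fun h => Continuous.aestronglyMeasurable ?_
      have := hu.continuous
      fun_prop
    · refine Eventually.of_forall fun h => Eventually.of_forall fun x => ?_
      rw [norm_mul]
      refine mul_le_of_le_one_left (norm_nonneg _) ?_
      rw [Real.norm_eq_abs, abs_of_nonneg (le_max_left _ _)]
      exact max_le zero_le_one (min_le_left _ _)
    · refine Eventually.of_forall fun x => ?_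
      by_cases hx : x ∈ tsupport φ
      · refine tendsto_const_nhds.congr' ?_
        by_cases hxt : t < u x
        · have : ∀ᶠ h : ℝ in nhdsWithin 0 (Ioi 0), h < u x - t :=
            (gt_mem_nhds (sub_pos.2 hxt)).filter_mono nhdsWithin_le_nhds
          filter_upwards [this, self_mem_nhdsWithin] with h h1 (h2 : 0 < h)
          have : 1 ≤ h⁻¹ * (u x - t) := by
            rw [inv_mul_eq_div, le_div_iff₀ h2]
            linarith
          rw [min_eq_left this]
          simp [indicator, hsupp hx, hxt]
        · filter_upwards [self_mem_nhdsWithin] with h (h2 : 0 < h)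
          have : h⁻¹ * (u x - t) ≤ 0 :=
            mul_nonpos_of_nonneg_of_nonpos (by positivity) (by linarith)
          rw [max_eq_left ((min_le_right _ _).trans this)]
          simp [indicator, hxt]
      · simp [hdiv0 x hx, indicator]
  · filter_upwards [hc, self_mem_nhdsWithin] with h h1 (h2 : 0 < h)
    exact (integral_truncation_mul_div_le hu hΩ hfin hφ hφc hsupp hφ1 h2).trans h1

/-- The perimeter of a superlevel set is bounded by the lower right derivative of the
total variation. -/
theorem relPerimeter_superlevel_le {n : ℕ} {K : NNReal}
    {u : EuclideanSpace ℝ (Fin n) → ℝ} (hu : LipschitzWith K u)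
    {Ω : Set (EuclideanSpace ℝ (Fin n))} (hΩ : MeasurableSet Ω) (hfin : volume Ω ≠ ⊤)
    {t c : ℝ} (hc0 : 0 ≤ c) (hc : ∀ᶠ h in nhdsWithin 0 (Ioi 0),
      h⁻¹ * ∫ x in {x ∈ Ω | t < u x ∧ u x ≤ t + h}, ‖fderiv ℝ u x‖ ≤ c) :
    relPerimeter Ω {x ∈ Ω | t < u x} ≤ c := by
  refine Real.sSup_le ?_ hc0
  rintro r ⟨φ, hφ, hφc, hsupp, hφ1, rfl⟩
  exact setIntegral_div_superlevel_le hu hΩ hfin hφ hφc hsupp hφ1 hc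

theorem sq_setIntegral_le {α : Type*} [MeasurableSpace α] {ν : Measure α} {A : Set α}
    {f : α → ℝ} (hA : ν A ≠ ⊤) (hf : IntegrableOn f A ν)
    (hf2 : IntegrableOn (fun x => f x ^ 2) A ν) :
    (∫ x in A, f x ∂ν) ^ 2 ≤ ν.real A * ∫ x in A, f x ^ 2 ∂ν := by
  have hquad : ∀ a : ℝ, 0 ≤ ν.real A * (a * a) + (-(2 * ∫ x in A, f x ∂ν)) * a
      + ∫ x in A, f x ^ 2 ∂ν := by
    intro a
    have h0 : 0 ≤ ∫ x in A, (a - f x) ^ 2 ∂ν := integral_nonneg fun x => sq_nonneg _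
    have hexp : ∀ x, (a - f x) ^ 2 = (a * a - (2 * a) * f x) + f x ^ 2 := fun x => by ring
    have hc : IntegrableOn (fun _ : α => a * a) A ν := integrableOn_const hA
    simp only [hexp] at h0
    rw [integral_add (f := fun x => a * a - 2 * a * f x) (hc.sub (hf.const_mul _)) hf2,
      integral_sub hc (hf.const_mul _),
      setIntegral_const, smul_eq_mul, integral_const_mul (2 * a)] at h0
    linarith
  have := discrim_le_zero hquad
  rw [discrim] at this
  linarith

section Rearrangement

variable {n : ℕ} {Ω : Set (EuclideanSpace ℝ (Fin n))} {u : EuclideanSpace ℝ (Fin n) → ℝ}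

theorem antitone_distrib_s9 (hfin : volume Ω ≠ ⊤) : Antitone (distrib Ω u) := fun _ _ hst =>
  ENNReal.toReal_mono (ne_top_of_le_ne_top hfin (measure_mono (sep_subset Ω _)))
    (measure_mono fun _ hx => ⟨hx.1, hst.trans_lt hx.2⟩)

theorem distrib_nonneg (t : ℝ) : 0 ≤ distrib Ω u t := ENNReal.toReal_nonneg

theorem distrib_of_neg (hu0 : ∀ x ∈ Ω, 0 ≤ u x) {t : ℝ} (ht : t < 0) :
    distrib Ω u t = (volume Ω).toReal := by
  have : {x ∈ Ω | t < u x} = Ω := sep_eq_self_iff_mem_true.2 fun x hx => ht.trans_le (hu0 x hx)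
  rw [distrib, this]

theorem distrib_of_forall_le {B : ℝ} (hB : ∀ x ∈ Ω, u x ≤ B) : distrib Ω u B = 0 := by
  have : {x ∈ Ω | B < u x} = ∅ := sep_eq_empty_iff_mem_false.2 fun x hx => not_lt.2 (hB x hx)
  rw [distrib, this]
  simp

theorem exists_gt_lt_distrib (hfin : volume Ω ≠ ⊤) {t s : ℝ} (hs : s < distrib Ω u t) :
    ∃ t' > t, s < distrib Ω u t' := by
  have hmono : Monotone fun k : ℕ => {x ∈ Ω | t + 1 / ((k : ℝ) + 1) < u x} := fun k l hkl x hx =>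
    ⟨hx.1, lt_of_le_of_lt (add_le_add_right (Nat.one_div_le_one_div hkl) t) hx.2⟩
  have hU : ⋃ k : ℕ, {x ∈ Ω | t + 1 / ((k : ℝ) + 1) < u x} = {x ∈ Ω | t < u x} := by
    ext x
    simp only [mem_iUnion, mem_ofPred_eq]
    constructor
    · rintro ⟨k, hx, hk⟩
      have : (0 : ℝ) < 1 / ((k : ℝ) + 1) := Nat.one_div_pos_of_nat
      exact ⟨hx, by linarith⟩
    · rintro ⟨hx, ht⟩
      obtain ⟨k, hk⟩ := exists_nat_one_div_lt (sub_pos.2 ht)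
      exact ⟨k, hx, by linarith⟩
  have hlim := tendsto_measure_iUnion_atTop (μ := volume) hmono
  rw [hU] at hlim
  have hlim' : Tendsto (fun k : ℕ => distrib Ω u (t + 1 / ((k : ℝ) + 1))) atTop
      (nhds (distrib Ω u t)) :=
    (ENNReal.tendsto_toReal (ne_top_of_le_ne_top hfin (measure_mono (sep_subset Ω _)))).comp hlim
  obtain ⟨k, hk⟩ := (hlim'.eventually (lt_mem_nhds hs)).exists
  have : (0 : ℝ) < 1 / ((k : ℝ) + 1) := Nat.one_div_pos_of_nat
  exact ⟨_, by linarith, hk⟩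

theorem bddBelow_setOf_distrib_le (hu0 : ∀ x ∈ Ω, 0 ≤ u x) {s : ℝ}
    (hs : s < (volume Ω).toReal) : BddBelow {t : ℝ | distrib Ω u t ≤ s} := by
  refine ⟨0, fun t ht => ?_⟩
  by_contra! h
  rw [mem_ofPred_eq, distrib_of_neg hu0 h] at ht
  linarith

theorem rearr_le (hu0 : ∀ x ∈ Ω, 0 ≤ u x) {s t : ℝ} (hs : s < (volume Ω).toReal)
    (ht : distrib Ω u t ≤ s) : rearr Ω u s ≤ t :=
  csInf_le (bddBelow_setOf_distrib_le hu0 hs) ht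

theorem rearr_nonneg (hu0 : ∀ x ∈ Ω, 0 ≤ u x) {s : ℝ} (hs : s < (volume Ω).toReal) :
    0 ≤ rearr Ω u s := by
  refine Real.sInf_nonneg fun t ht => ?_
  by_contra! h
  rw [mem_ofPred_eq, distrib_of_neg hu0 h] at ht
  linarith

theorem rearr_of_le (hfin : volume Ω ≠ ⊤) {s : ℝ} (hs : (volume Ω).toReal ≤ s) :
    rearr Ω u s = 0 := by
  have : {t : ℝ | distrib Ω u t ≤ s} = univ := eq_univ_of_forall fun t =>
    (ENNReal.toReal_mono hfin (measure_mono (sep_subset Ω _))).trans hs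
  rw [rearr, this, Real.sInf_univ]

theorem distrib_rearr_le (hfin : volume Ω ≠ ⊤) {B : ℝ} (hB : ∀ x ∈ Ω, u x ≤ B) {s : ℝ}
    (hs0 : 0 ≤ s) : distrib Ω u (rearr Ω u s) ≤ s := by
  by_contra! h
  obtain ⟨t', ht', hst'⟩ := exists_gt_lt_distrib hfin h
  obtain ⟨t, ht, htt'⟩ := exists_lt_of_csInf_lt
    (show {t : ℝ | distrib Ω u t ≤ s}.Nonempty from ⟨B, (distrib_of_forall_le hB).trans_le hs0⟩)
    ht'
  have h1 := antitone_distrib_s9 (u := u) hfin htt'.le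
  have h2 : distrib Ω u t ≤ s := ht
  linarith

theorem antitoneOn_rearr (hfin : volume Ω ≠ ⊤) (hu0 : ∀ x ∈ Ω, 0 ≤ u x) {B : ℝ}
    (hB : ∀ x ∈ Ω, u x ≤ B) : AntitoneOn (rearr Ω u) (Ici 0) := by
  intro a ha b hb hab
  rcases lt_or_ge b (volume Ω).toReal with hbM | hbM
  · exact rearr_le hu0 hbM ((distrib_rearr_le hfin hB ha).trans hab)
  · rw [rearr_of_le hfin hbM]
    rcases lt_or_ge a (volume Ω).toReal with haM | haM
    · exact rearr_nonneg hu0 haM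
    · rw [rearr_of_le hfin haM]

theorem eventually_lt_distrib_add (hfin : volume Ω ≠ ⊤) {t s : ℝ} (hs : s < distrib Ω u t) :
    ∀ᶠ h in nhdsWithin 0 (Ioi 0), s < distrib Ω u (t + h) := by
  obtain ⟨t', ht', hst'⟩ := exists_gt_lt_distrib hfin hs
  have : ∀ᶠ h : ℝ in nhdsWithin 0 (Ioi 0), h < t' - t :=
    (gt_mem_nhds (sub_pos.2 ht')).filter_mono nhdsWithin_le_nhds
  filter_upwards [this] with h hh
  exact hst'.trans_le (antitone_distrib_s9 hfin (by linarith))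

theorem superlevel_eq_union {t h : ℝ} (hh : 0 ≤ h) :
    {x ∈ Ω | t < u x} = {x ∈ Ω | t < u x ∧ u x ≤ t + h} ∪ {x ∈ Ω | t + h < u x} := by
  ext x
  simp only [mem_union, mem_ofPred_eq]
  constructor
  · rintro ⟨hx, ht⟩
    rcases le_or_gt (u x) (t + h) with h1 | h1
    · exact Or.inl ⟨hx, ht, h1⟩
    · exact Or.inr ⟨hx, h1⟩
  · rintro (⟨hx, ht, -⟩ | ⟨hx, ht⟩)
    · exact ⟨hx, ht⟩
    · exact ⟨hx, by linarith⟩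

theorem disjoint_strip_superlevel {t h : ℝ} :
    Disjoint {x ∈ Ω | t < u x ∧ u x ≤ t + h} {x ∈ Ω | t + h < u x} :=
  Set.disjoint_left.2 fun _ hx hx' => not_lt.2 hx.2.2 hx'.2

theorem measurableSet_superlevel (hΩ : MeasurableSet Ω) (hu : Measurable u) (t : ℝ) :
    MeasurableSet {x ∈ Ω | t < u x} :=
  hΩ.inter (measurableSet_lt measurable_const hu)

theorem measureReal_strip (hΩ : MeasurableSet Ω) (hfin : volume Ω ≠ ⊤) (hu : Measurable u)
    {t h : ℝ} (hh : 0 ≤ h) :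
    volume.real {x ∈ Ω | t < u x ∧ u x ≤ t + h} = distrib Ω u t - distrib Ω u (t + h) := by
  have hsub : ∀ p : EuclideanSpace ℝ (Fin n) → Prop, volume {x ∈ Ω | p x} ≠ ⊤ := fun p =>
    ne_top_of_le_ne_top hfin (measure_mono (sep_subset Ω p))
  have : volume.real {x ∈ Ω | t < u x} = volume.real {x ∈ Ω | t < u x ∧ u x ≤ t + h}
      + volume.real {x ∈ Ω | t + h < u x} := by
    rw [superlevel_eq_union hh, measureReal_union disjoint_strip_superlevel
      (measurableSet_superlevel hΩ hu _) (hsub _) (hsub _)]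
  change distrib Ω u t = _ + distrib Ω u (t + h) at this
  linarith

theorem setIntegral_strip (hΩ : MeasurableSet Ω) (hu : Measurable u)
    {f : EuclideanSpace ℝ (Fin n) → ℝ} (hf : IntegrableOn f Ω) {t h : ℝ} (hh : 0 ≤ h) :
    ∫ x in {x ∈ Ω | t < u x ∧ u x ≤ t + h}, f x
      = (∫ x in {x ∈ Ω | t < u x}, f x) - ∫ x in {x ∈ Ω | t + h < u x}, f x := by
  have : ∫ x in {x ∈ Ω | t < u x}, f x = (∫ x in {x ∈ Ω | t < u x ∧ u x ≤ t + h}, f x)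
      + ∫ x in {x ∈ Ω | t + h < u x}, f x := by
    rw [superlevel_eq_union hh, setIntegral_union disjoint_strip_superlevel
      (measurableSet_superlevel hΩ hu _) (hf.mono_set (sep_subset Ω _))
      (hf.mono_set (sep_subset Ω _))]
  linarith

theorem antitone_setIntegral_superlevel {f : EuclideanSpace ℝ (Fin n) → ℝ}
    (hf : IntegrableOn f Ω) (hf0 : ∀ x, 0 ≤ f x) :
    Antitone fun t => ∫ x in {x ∈ Ω | t < u x}, f x := fun _ _ hst =>
  setIntegral_mono_set (hf.mono_set (sep_subset Ω _)) (Eventually.of_forall hf0)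
    (LE.le.eventuallyLE fun _ hx => ⟨hx.1, hst.trans_lt hx.2⟩)

theorem setIntegral_superlevel_rearr_distrib_le (hΩ : MeasurableSet Ω) (hfin : volume Ω ≠ ⊤)
    (hu : Measurable u) (hu0 : ∀ x ∈ Ω, 0 ≤ u x) {B : ℝ} (hB : ∀ x ∈ Ω, u x ≤ B)
    {f : EuclideanSpace ℝ (Fin n) → ℝ} (hf : IntegrableOn f Ω) {t : ℝ}
    (ht : distrib Ω u t < (volume Ω).toReal) :
    ∫ x in {x ∈ Ω | rearr Ω u (distrib Ω u t) < u x}, f x ≤ ∫ x in {x ∈ Ω | t < u x}, f x := by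
  set r := rearr Ω u (distrib Ω u t) with hr
  have hrt : r ≤ t := rearr_le hu0 ht le_rfl
  have hd : distrib Ω u r ≤ distrib Ω u t := distrib_rearr_le hfin hB (distrib_nonneg t)
  have h0 : volume {x ∈ Ω | r < u x ∧ u x ≤ r + (t - r)} = 0 := by
    rw [← measureReal_eq_zero_iff
      (ne_top_of_le_ne_top hfin (measure_mono (sep_subset Ω fun x => r < u x ∧ u x ≤ r + (t - r)))),
      measureReal_strip hΩ hfin hu (sub_nonneg.2 hrt)]
    have := antitone_distrib_s9 (u := u) hfin hrt
    rw [add_sub_cancel]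
    linarith
  have h1 := setIntegral_strip hΩ hu hf (t := r) (sub_nonneg.2 hrt)
  rw [setIntegral_measure_zero _ h0, add_sub_cancel] at h1
  linarith

/-- Pointwise form of the comparison: the isoperimetric lower bound at the level `rearr Ω u s`
controls the derivative of the rearrangement. -/
theorem mul_neg_deriv_rearr_le {K : NNReal} (hu : LipschitzWith K u) (hΩ : MeasurableSet Ω)
    (hfin : volume Ω ≠ ⊤) (hu0 : ∀ x ∈ Ω, 0 ≤ u x) {B : ℝ} (hB : ∀ x ∈ Ω, u x ≤ B)
    {P : ℝ → ℝ} (hiso : ∀ t : ℝ, 0 ≤ t → P (distrib Ω u t) ≤ relPerimeter Ω {x ∈ Ω | t < u x})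
    {s : ℝ} (hs0 : 0 < s) (hsM : s < (volume Ω).toReal) {d g : ℝ} (hd : d < 0) (hg : 0 ≤ g)
    (hv : HasDerivAt (rearr Ω u) d s)
    (hG : HasDerivAt
      (fun s => ∫ x in {x ∈ Ω | rearr Ω u s < u x}, ‖fderiv ℝ u x‖ ^ 2) g s) :
    P s * (-d) ≤ √g := by
  set v := rearr Ω u with hvdef
  set H : ℝ → ℝ := fun t => ∫ x in {x ∈ Ω | t < u x}, ‖fderiv ℝ u x‖ ^ 2 with hH
  have hf2 := integrableOn_norm_fderiv_pow hu hfin 2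
  have hanti := antitoneOn_rearr hfin hu0 hB
  have hvs : ∀ c < -d, ∀ᶠ τ in nhdsWithin s (Iio s), c * (s - τ) < v τ - v s := by
    intro c hc
    have h1 := (hasDerivAt_iff_tendsto_slope.1 hv).mono_left
      (nhdsWithin_mono s fun τ (hτ : τ < s) => hτ.ne)
    filter_upwards [h1.eventually (gt_mem_nhds (show d < -c by linarith)),
      self_mem_nhdsWithin] with τ h2 (h3 : τ < s)
    rw [slope_def_field, div_lt_iff_of_neg (by linarith)] at h2
    linarith
  have hGs : ∀ ε > 0, ∀ᶠ τ in nhdsWithin s (Iio s),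
      H (v s) - H (v τ) < (g + ε) * (s - τ) := by
    intro ε hε
    have h1 := (hasDerivAt_iff_tendsto_slope.1 hG).mono_left
      (nhdsWithin_mono s fun τ (hτ : τ < s) => hτ.ne)
    filter_upwards [h1.eventually (gt_mem_nhds (show g < g + ε by linarith)),
      self_mem_nhdsWithin] with τ h2 (h3 : τ < s)
    rw [slope_def_field, div_lt_iff_of_neg (by linarith)] at h2
    linarith
  have hμ : distrib Ω u (v s) = s := by
    refine le_antisymm (distrib_rearr_le hfin hB hs0.le) ?_
    by_contra! h
    have h1 : ∀ᶠ τ in nhdsWithin s (Iio s), distrib Ω u (v s) < τ :=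
      (lt_mem_nhds h).filter_mono nhdsWithin_le_nhds
    obtain ⟨τ, hτ, hτ', hτs : τ < s⟩ := (h1.and ((hvs 0 (by linarith)).and
      self_mem_nhdsWithin)).exists
    have := rearr_le hu0 (hτs.trans hsM) hτ.le
    linarith
  have key : ∀ ε ∈ Ioo 0 (-d), P s * (-d - ε) ≤ √(g + ε) := by
    rintro ε ⟨hε, hεd⟩
    have hc : 0 < -d - ε := by linarith
    obtain ⟨l, hl, hlsub⟩ := (mem_nhdsLT_iff_exists_Ioo_subset).1
      ((hvs (-d - ε) (by linarith)).and (hGs ε hε))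
    rw [← le_div_iff₀ hc, ← hμ]
    refine (hiso _ (rearr_nonneg hu0 hsM)).trans
      (relPerimeter_superlevel_le hu hΩ hfin (by positivity) ?_)
    have hl0 : max l 0 < distrib Ω u (v s) := by
      rw [hμ]
      exact max_lt hl hs0
    filter_upwards [eventually_lt_distrib_add hfin hl0, self_mem_nhdsWithin] with h hs' (hh : 0 < h)
    set s' := distrib Ω u (v s + h) with hs'def
    have hs's : s' ≤ s := hμ ▸ antitone_distrib_s9 hfin (by linarith)
    have hτ : (-d - ε) * (s - s') ≤ v s' - v s ∧ H (v s) - H (v s') ≤ (g + ε) * (s - s') := by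
      rcases hs's.eq_or_lt with heq | hlt
      · simp [heq]
      · have := hlsub ⟨(le_max_left _ _).trans_lt hs', hlt⟩
        exact ⟨this.1.le, this.2.le⟩
    have hvh : v s' ≤ v s + h := rearr_le hu0 (hs's.trans_lt hsM) le_rfl
    have hHle : H (v s') ≤ H (v s + h) :=
      setIntegral_superlevel_rearr_distrib_le hΩ hfin hu.continuous.measurable hu0 hB hf2
        (hs's.trans_lt hsM)
    have hss : (-d - ε) * (s - s') ≤ h := by linarith
    have hAfin : volume {x ∈ Ω | v s < u x ∧ u x ≤ v s + h} ≠ ⊤ :=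
      ne_top_of_le_ne_top hfin (measure_mono (sep_subset Ω _))
    have hCS := sq_setIntegral_le (f := fun x => ‖fderiv ℝ u x‖) hAfin
      (by simpa only [pow_one] using integrableOn_norm_fderiv_pow hu hAfin 1)
      (integrableOn_norm_fderiv_pow hu hAfin 2)
    rw [measureReal_strip hΩ hfin hu.continuous.measurable hh.le,
      setIntegral_strip hΩ hu.continuous.measurable hf2 hh.le, hμ] at hCS
    change _ ≤ (s - s') * (H (v s) - H (v s + h)) at hCS
    have hI : ∫ x in {x ∈ Ω | v s < u x ∧ u x ≤ v s + h}, ‖fderiv ℝ u x‖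
        ≤ (s - s') * √(g + ε) := by
      refine le_of_sq_le_sq (hCS.trans ?_) (mul_nonneg (by linarith) (Real.sqrt_nonneg _))
      rw [mul_pow, Real.sq_sqrt (by positivity), sq, mul_assoc]
      refine mul_le_mul_of_nonneg_left ?_ (by linarith)
      linarith
    rw [inv_mul_eq_div, div_le_div_iff₀ hh hc]
    calc _ ≤ (s - s') * √(g + ε) * (-d - ε) := by gcongr
      _ = √(g + ε) * ((-d - ε) * (s - s')) := by ring
      _ ≤ √(g + ε) * h := by gcongr
  have hl1 : Tendsto (fun ε : ℝ => P s * (-d - ε)) (nhdsWithin 0 (Ioi 0))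
      (nhds (P s * (-d - 0))) :=
    (Continuous.tendsto (by fun_prop) 0).mono_left nhdsWithin_le_nhds
  have hl2 : Tendsto (fun ε : ℝ => √(g + ε)) (nhdsWithin 0 (Ioi 0)) (nhds √(g + 0)) :=
    (Continuous.tendsto (by fun_prop) 0).mono_left nhdsWithin_le_nhds
  rw [sub_zero] at hl1
  rw [add_zero] at hl2
  exact le_of_tendsto_of_tendsto hl1 hl2
    (mem_of_superset (Ioo_mem_nhdsGT (by linarith)) key)

end Rearrangement

theorem unitBallVol_pos (n : ℕ) : 0 < unitBallVol n :=
  ENNReal.toReal_pos (measure_ball_pos _ _ one_pos).ne' measure_ball_lt_top.ne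

/-- The map `x ↦ cₙ ‖x‖ ^ n` sends Lebesgue measure on a centred ball to Lebesgue measure on an
interval. -/
theorem map_volume_ball_unitBallVol_mul_norm_pow {n : ℕ} (hn : n ≠ 0) {R : ℝ} (hR : 0 ≤ R) :
    Measure.map (fun x : EuclideanSpace ℝ (Fin n) => unitBallVol n * ‖x‖ ^ n)
      (volume.restrict (ball 0 R)) = volume.restrict (Ioc 0 (unitBallVol n * R ^ n)) := by
  have : NeZero n := ⟨hn⟩
  have hc := unitBallVol_pos n
  have hq : Measurable fun x : EuclideanSpace ℝ (Fin n) => unitBallVol n * ‖x‖ ^ n := by fun_prop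
  have hvol1 : volume (ball (0 : EuclideanSpace ℝ (Fin n)) 1) = ENNReal.ofReal (unitBallVol n) :=
    (ENNReal.ofReal_toReal measure_ball_lt_top.ne).symm
  have : IsFiniteMeasure (volume.restrict (ball (0 : EuclideanSpace ℝ (Fin n)) R)) :=
    ⟨by simpa using measure_ball_lt_top⟩
  refine Measure.ext_of_Iic _ _ fun a => ?_
  rw [Measure.map_apply hq measurableSet_Iic, Measure.restrict_apply (hq measurableSet_Iic),
    Measure.restrict_apply measurableSet_Iic]
  rcases lt_or_ge a 0 with ha | ha
  · have h1 : (fun x : EuclideanSpace ℝ (Fin n) => unitBallVol n * ‖x‖ ^ n) ⁻¹' Iic a = ∅ := by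
      refine eq_empty_of_forall_notMem fun x (hx : unitBallVol n * ‖x‖ ^ n ≤ a) => ?_
      have : 0 ≤ unitBallVol n * ‖x‖ ^ n := by positivity
      linarith
    have h2 : Iic a ∩ Ioc 0 (unitBallVol n * R ^ n) = ∅ :=
      eq_empty_of_forall_notMem fun x hx => by
        have := hx.1
        have := hx.2.1
        simp only [mem_Iic] at *
        linarith
    simp [h1, h2]
  obtain ⟨ρ, hρ, rfl⟩ : ∃ ρ : ℝ, 0 ≤ ρ ∧ unitBallVol n * ρ ^ n = a := by
    refine ⟨(a / unitBallVol n) ^ ((n : ℝ)⁻¹), by positivity, ?_⟩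
    rw [Real.rpow_inv_natCast_pow (by positivity) hn]
    field_simp
  have hpre : (fun x : EuclideanSpace ℝ (Fin n) => unitBallVol n * ‖x‖ ^ n) ⁻¹'
      Iic (unitBallVol n * ρ ^ n) = closedBall 0 ρ := by
    ext x
    simp only [mem_preimage, mem_Iic, mem_closedBall, dist_zero_right]
    rw [mul_le_mul_iff_right₀ hc, pow_le_pow_iff_left₀ (norm_nonneg x) hρ hn]
  rw [hpre]
  rcases lt_or_ge ρ R with hlt | hge
  · rw [inter_eq_left.2 (closedBall_subset_ball hlt), Measure.addHaar_closedBall _ _ hρ,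
      finrank_euclideanSpace_fin, hvol1, ← ENNReal.ofReal_mul (by positivity)]
    have : Iic (unitBallVol n * ρ ^ n) ∩ Ioc 0 (unitBallVol n * R ^ n)
        = Ioc 0 (unitBallVol n * ρ ^ n) := by
      rw [inter_comm, Ioc_inter_Iic, min_eq_right]
      gcongr
    rw [this, Real.volume_Ioc, sub_zero, mul_comm]
  · rw [inter_eq_right.2 (ball_subset_closedBall.trans (closedBall_subset_closedBall hge)),
      Measure.addHaar_ball _ _ hR, finrank_euclideanSpace_fin, hvol1,
      ← ENNReal.ofReal_mul (by positivity)]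
    have : Iic (unitBallVol n * ρ ^ n) ∩ Ioc 0 (unitBallVol n * R ^ n)
        = Ioc 0 (unitBallVol n * R ^ n) := by
      rw [inter_comm, Ioc_inter_Iic, min_eq_left]
      gcongr
    rw [this, Real.volume_Ioc, sub_zero, mul_comm]

theorem norm_fderiv_comp_mul_norm_pow_le {E : Type*} [NormedAddCommGroup E]
    [InnerProductSpace ℝ E] {v : ℝ → ℝ} {c : ℝ} (hc : 0 ≤ c) {k : ℕ} {x : E} (hx : x ≠ 0) {d : ℝ}
    (hv : HasDerivAt v d (c * ‖x‖ ^ k)) :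
    ‖fderiv ℝ (fun y => v (c * ‖y‖ ^ k)) x‖ ≤ |d| * (c * (k * ‖x‖ ^ (k - 1))) := by
  have hnorm : HasFDerivAt (fun y : E => ‖y‖) (fderiv ℝ (fun y : E => ‖y‖) x) x :=
    ((contDiffAt_norm ℝ hx (n := 1)).differentiableAt one_ne_zero).hasFDerivAt
  have h1 : ‖fderiv ℝ (fun y : E => ‖y‖) x‖ ≤ 1 :=
    NNReal.coe_one ▸ norm_fderiv_le_of_lipschitz ℝ lipschitzWith_one_norm
  have h2 := hv.comp_hasFDerivAt x ((hnorm.pow k).const_mul c)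
  have h3 := h2.fderiv
  change fderiv ℝ (fun y => v (c * ‖y‖ ^ k)) x = _ at h3
  rw [h3, norm_smul, norm_smul, norm_smul, Real.norm_eq_abs, Real.norm_eq_abs, Real.norm_eq_abs,
    abs_of_nonneg hc, nsmul_eq_mul, abs_of_nonneg (by positivity : 0 ≤ (k : ℝ) * ‖x‖ ^ (k - 1))]
  refine mul_le_mul_of_nonneg_left (mul_le_mul_of_nonneg_left ?_ hc) (abs_nonneg d)
  exact mul_le_of_le_one_right (by positivity) h1

/-- The weight produced by the chain rule in radial coordinates, written in terms of the volume
`cₙ r ^ n` of the ball of radius `r`. -/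
theorem mul_nat_mul_pow_eq {n : ℕ} (hn : n ≠ 0) {c r : ℝ} (hc : 0 < c) (hr : 0 < r) :
    c * (n * r ^ (n - 1)) = n * c ^ ((1 : ℝ) / n) * (c * r ^ n) ^ ((1 : ℝ) - 1 / n) := by
  have hn' : (n : ℝ) ≠ 0 := Nat.cast_ne_zero.2 hn
  have h1 : (r ^ n) ^ ((1 : ℝ) - 1 / n) = r ^ (n - 1) := by
    rw [← Real.rpow_natCast, ← Real.rpow_natCast, ← Real.rpow_mul hr.le,
      Nat.cast_sub (Nat.one_le_iff_ne_zero.2 hn)]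
    congr 1
    field_simp
    simp
  have h2 : c ^ ((1 : ℝ) / n) * c ^ ((1 : ℝ) - 1 / n) = c := by
    rw [← Real.rpow_add hc]
    simp
  rw [Real.mul_rpow hc.le (by positivity), h1]
  calc c * (n * r ^ (n - 1)) = n * r ^ (n - 1) * c := by ring
    _ = n * r ^ (n - 1) * (c ^ ((1 : ℝ) / n) * c ^ ((1 : ℝ) - 1 / n)) := by rw [h2]
    _ = _ := by ring

theorem AntitoneOn.ae_differentiableAt_Ioc {f : ℝ → ℝ} {a b : ℝ} (hf : AntitoneOn f (Ici a)) :
    ∀ᵐ s ∂volume.restrict (Ioc a b), DifferentiableAt ℝ f s := by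
  rw [ae_restrict_iff' measurableSet_Ioc]
  filter_upwards [hf.neg.ae_differentiableWithinAt_of_mem] with s hs hsm
  have := (hs hsm.1.le).differentiableAt (Ici_mem_nhds hsm.1)
  simpa using this.neg

/-- The estimate for a function that is Lipschitz on the whole space. -/
theorem integral_norm_fderiv_schwarz_sq_le {n : ℕ} (hn : n ≠ 0)
    {Ω : Set (EuclideanSpace ℝ (Fin n))} {u : EuclideanSpace ℝ (Fin n) → ℝ}
    (hΩ : MeasurableSet Ω) (hfin : volume Ω ≠ ⊤) {K : NNReal} (hu : LipschitzWith K u)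
    (hu0 : ∀ x ∈ Ω, 0 ≤ u x) {B : ℝ} (hB : ∀ x ∈ Ω, u x ≤ B) {γ : ℝ} (hγ : 0 < γ)
    (hiso : ∀ t : ℝ, 0 ≤ t →
      γ * (distrib Ω u t) ^ ((1 : ℝ) - 1 / n) ≤ relPerimeter Ω {x ∈ Ω | t < u x}) :
    ∫ x in ballSameVol Ω, ‖fderiv ℝ (schwarz Ω u) x‖ ^ 2
      ≤ ((n : ℝ) * (unitBallVol n) ^ ((1 : ℝ) / n) / γ) ^ 2
        * ∫ x in Ω, ‖fderiv ℝ u x‖ ^ 2 := by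
  have hcn := unitBallVol_pos n
  set M := (volume Ω).toReal with hM
  have hM0 : 0 ≤ M := ENNReal.toReal_nonneg
  set R := (M / unitBallVol n) ^ ((1 : ℝ) / n) with hR
  have hR0 : 0 ≤ R := by positivity
  have hMR : unitBallVol n * R ^ n = M := by
    rw [hR, one_div, Real.rpow_inv_natCast_pow (by positivity) hn]
    field_simp
  have hmap := map_volume_ball_unitBallVol_mul_norm_pow hn hR0
  rw [hMR] at hmap
  set q : EuclideanSpace ℝ (Fin n) → ℝ := fun x => unitBallVol n * ‖x‖ ^ n with hq
  have hqm : Measurable q := by fun_prop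
  set C := (n : ℝ) * (unitBallVol n) ^ ((1 : ℝ) / n) / γ with hC
  set H : ℝ → ℝ := fun t => ∫ x in {x ∈ Ω | t < u x}, ‖fderiv ℝ u x‖ ^ 2 with hH
  set G : ℝ → ℝ := fun s => H (rearr Ω u s) with hGdef
  have hf2 := integrableOn_norm_fderiv_pow hu hfin 2
  have hanti := antitoneOn_rearr hfin hu0 hB
  have hHanti : Antitone H := antitone_setIntegral_superlevel hf2 fun x => by positivity
  have hGmono : MonotoneOn G (Ici 0) := fun a ha b hb hab => hHanti (hanti ha hb hab)
  have hGmono' : MonotoneOn G (uIcc 0 M) :=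
    hGmono.mono (by rw [uIcc_of_le hM0]; exact Icc_subset_Ici_self)
  have hGint : Integrable (deriv G) (volume.restrict (Ioc 0 M)) :=
    (intervalIntegrable_iff_integrableOn_Ioc_of_le hM0).1 hGmono'.intervalIntegrable_deriv
  have hGle : ∫ s in Ioc 0 M, deriv G s ≤ ∫ x in Ω, ‖fderiv ℝ u x‖ ^ 2 := by
    have h1 := hGmono'.intervalIntegral_deriv_mem_uIcc
    have h2 : G 0 ≤ G M := hGmono self_mem_Ici hM0 hM0
    rw [intervalIntegral.integral_of_le hM0, uIcc_of_le (sub_nonneg.2 h2)] at h1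
    have h3 : 0 ≤ G 0 := setIntegral_nonneg_of_ae (Eventually.of_forall fun x => by positivity)
    have h4 : G M ≤ ∫ x in Ω, ‖fderiv ℝ u x‖ ^ 2 :=
      setIntegral_mono_set hf2 (Eventually.of_forall fun x => by positivity)
        (LE.le.eventuallyLE (sep_subset Ω _))
    linarith [h1.2]
  have hae : ∀ᵐ s ∂volume.restrict (Ioc 0 M), s ∈ Ioo 0 M ∧
      DifferentiableAt ℝ (rearr Ω u) s ∧ DifferentiableAt ℝ G s := by
    have h1 := hGmono.neg.ae_differentiableAt_Ioc (b := M)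
    have h2 : ∀ᵐ s ∂volume.restrict (Ioc 0 M), s ∈ Ioo 0 M := by
      rw [← restrict_Ioo_eq_restrict_Ioc]
      exact ae_restrict_mem measurableSet_Ioo
    filter_upwards [h1, h2, hanti.ae_differentiableAt_Ioc (b := M)] with s hs1 hs2 hs3
    exact ⟨hs2, hs3, by simpa using hs1.neg⟩
  rw [← hmap] at hae hGint
  have hbound : ∀ᵐ x ∂volume.restrict (ball (0 : EuclideanSpace ℝ (Fin n)) R),
      ‖fderiv ℝ (schwarz Ω u) x‖ ^ 2 ≤ C ^ 2 * deriv G (q x) := by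
    filter_upwards [ae_of_ae_map hqm.aemeasurable hae] with x ⟨⟨hs0, hsM⟩, hv, hG⟩
    have hx : x ≠ 0 := by
      rintro rfl
      simp [hq, hn] at hs0
    have h1 := norm_fderiv_comp_mul_norm_pow_le hcn.le hx hv.hasDerivAt
    change ‖fderiv ℝ (schwarz Ω u) x‖ ≤ _ at h1
    rw [mul_nat_mul_pow_eq hn hcn (norm_pos_iff.2 hx)] at h1
    change _ ≤ |deriv (rearr Ω u) (q x)| * (n * unitBallVol n ^ ((1 : ℝ) / n)
      * q x ^ ((1 : ℝ) - 1 / n)) at h1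
    have hg0 : 0 ≤ deriv G (q x) := by
      rw [← derivWithin_of_mem_nhds (Ici_mem_nhds hs0)]
      exact hGmono.derivWithin_nonneg
    have hd0 : deriv (rearr Ω u) (q x) ≤ 0 := by
      rw [← derivWithin_of_mem_nhds (Ici_mem_nhds hs0)]
      exact hanti.derivWithin_nonpos
    have h2 : γ * q x ^ ((1 : ℝ) - 1 / n) * |deriv (rearr Ω u) (q x)| ≤ √(deriv G (q x)) := by
      rcases hd0.eq_or_lt with hd | hd
      · rw [hd, abs_zero, mul_zero]
        exact Real.sqrt_nonneg _
      · rw [abs_of_neg hd]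
        exact mul_neg_deriv_rearr_le hu hΩ hfin hu0 hB
          (P := fun m => γ * m ^ ((1 : ℝ) - 1 / n)) hiso hs0 hsM hd hg0 hv.hasDerivAt hG.hasDerivAt
    have h3 : ‖fderiv ℝ (schwarz Ω u) x‖ ≤ C * √(deriv G (q x)) := by
      calc _ ≤ _ := h1
        _ = C * (γ * q x ^ ((1 : ℝ) - 1 / n) * |deriv (rearr Ω u) (q x)|) := by
          rw [hC]
          field_simp
        _ ≤ _ := by gcongr
    calc _ ≤ (C * √(deriv G (q x))) ^ 2 := by gcongr
      _ = _ := by rw [mul_pow, Real.sq_sqrt hg0]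
  calc ∫ x in ballSameVol Ω, ‖fderiv ℝ (schwarz Ω u) x‖ ^ 2
      ≤ ∫ x in ball (0 : EuclideanSpace ℝ (Fin n)) R, C ^ 2 * deriv G (q x) :=
        integral_mono_of_nonneg (Eventually.of_forall fun x => by positivity)
          ((hGint.comp_measurable hqm).const_mul _) hbound
    _ = C ^ 2 * ∫ s in Ioc 0 M, deriv G s := by
      rw [integral_const_mul, ← hmap, integral_map hqm.aemeasurable hGint.aestronglyMeasurable]
    _ ≤ _ := by gcongr

theorem polya_szego_type_estimate {n : ℕ} (hn : 2 ≤ n)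
    (Ω : Set (EuclideanSpace ℝ (Fin n))) (u : EuclideanSpace ℝ (Fin n) → ℝ)
    (hΩo : IsOpen Ω) (hΩbd : Bornology.IsBounded Ω)
    (L : NNReal) (hu : LipschitzOnWith L u Ω)
    (hu0 : ∀ x ∈ Ω, 0 ≤ u x)
    (γ : ℝ) (hγ : 0 < γ)
    (hiso : ∀ t : ℝ, 0 ≤ t →
      γ * (distrib Ω u t) ^ ((1 : ℝ) - 1 / n) ≤ relPerimeter Ω {x ∈ Ω | t < u x}) :
    ∫ x in ballSameVol Ω, ‖fderiv ℝ (schwarz Ω u) x‖ ^ 2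
      ≤ ((n : ℝ) * (unitBallVol n) ^ ((1 : ℝ) / n) / γ) ^ 2
        * ∫ x in Ω, ‖fderiv ℝ u x‖ ^ 2 := by
  obtain ⟨U, hU, hEq⟩ := hu.extend_real
  obtain ⟨B, hB⟩ := (hU.isBounded_image hΩbd).bddAbove
  have hset : ∀ t : ℝ, {x ∈ Ω | t < u x} = {x ∈ Ω | t < U x} := fun t => by
    ext x
    simp +contextual [hEq.eq_of_mem]
  have hdist : distrib Ω u = distrib Ω U := funext fun t => by simp only [distrib, hset]
  have hschwarz : schwarz Ω u = schwarz Ω U := funext fun x => by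
    simp only [schwarz, rearr, hdist]
  have hint : ∫ x in Ω, ‖fderiv ℝ u x‖ ^ 2 = ∫ x in Ω, ‖fderiv ℝ U x‖ ^ 2 := by
    refine setIntegral_congr_fun hΩo.measurableSet fun x hx => ?_
    simp only [(hEq.eventuallyEq_of_mem (hΩo.mem_nhds hx)).fderiv_eq]
  rw [hschwarz, hint]
  refine integral_norm_fderiv_schwarz_sq_le (by lia) hΩo.measurableSet hΩbd.measure_lt_top.ne hU
    (fun x hx => hEq hx ▸ hu0 x hx) (fun x hx => hB (mem_image_of_mem U hx)) hγ fun t ht => ?_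
  rw [← hdist, ← hset]
  exact hiso t ht
end
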